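/- For reals a, b, c, d ∈ [0,1] and p ≥ 2, we have (ac - bd)^p ≤ 2^{p-1} [ (1/2)(c + d)(a - b)^p + a^{p/2} b^{p/2} (c - d)^p ], where all powers of possibly negative quantities are interpreted as powers of absolute values. -/

import Mathlib

theorem stmt_2_aux (a b c d : ℝ) (hc : c ≤ 1) (hd0 : 0 ≤ d) (h : d ≤ c) :
    (a * c - b * d) ^ 2 ≤ 2 * ((1 / 2) * (c + d) * (a - b) ^ 2 + a * b * (c - d) ^ 2) := by
  have h1 : 0 ≤ (1 - c) * (c + d) * (a - b) ^ 2 :=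
    mul_nonneg (mul_nonneg (by linarith) (by linarith)) (sq_nonneg _)
  have h2 : 0 ≤ d * (c - d) * (a - b) ^ 2 :=
    mul_nonneg (mul_nonneg hd0 (by linarith)) (sq_nonneg _)
  have h3 := sq_nonneg (d * (a - b) - (c - d) * b)
  linarith

theorem stmt_2 (p a b c d : ℝ) (hp : 2 ≤ p)
    (ha : a ∈ Set.Icc (0 : ℝ) 1) (hb : b ∈ Set.Icc (0 : ℝ) 1)
    (hc : c ∈ Set.Icc (0 : ℝ) 1) (hd : d ∈ Set.Icc (0 : ℝ) 1) :
    |a * c - b * d| ^ p ≤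
      2 ^ (p - 1) *
        ((1 / 2) * (c + d) * |a - b| ^ p + a ^ (p / 2) * b ^ (p / 2) * |c - d| ^ p) := by
  obtain ⟨ha0, ha1⟩ := ha
  obtain ⟨hb0, hb1⟩ := hb
  obtain ⟨hc0, hc1⟩ := hc
  obtain ⟨hd0, hd1⟩ := hd
  have key : (a * c - b * d) ^ 2 ≤
      2 * ((1 / 2) * (c + d) * (a - b) ^ 2 + a * b * (c - d) ^ 2) := by
    rcases le_total d c with h | h
    · exact stmt_2_aux a b c d hc1 hd0 h
    · have := stmt_2_aux b a d c hd1 hc0 h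
      linarith
  have hsq : ∀ x : ℝ, (x ^ 2) ^ (p / 2) = |x| ^ p := by
    intro x
    rw [← sq_abs, ← Real.rpow_natCast, ← Real.rpow_mul (abs_nonneg x)]
    congr 1
    push_cast
    ring
  have hq : 1 ≤ p / 2 := by linarith
  set U := (1 / 2) * (c + d) * (a - b) ^ 2 with hU
  set V := a * b * (c - d) ^ 2 with hV
  have hU0 : 0 ≤ U := by positivity
  have hV0 : 0 ≤ V := by positivity
  have e1 : U ^ (p / 2) ≤ (1 / 2) * (c + d) * |a - b| ^ p := by
    rw [hU, Real.mul_rpow (by positivity) (by positivity), hsq]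
    gcongr
    exact Real.rpow_le_self_of_le_one (by positivity) (by linarith) hq
  have e2 : V ^ (p / 2) = a ^ (p / 2) * b ^ (p / 2) * |c - d| ^ p := by
    rw [hV, Real.mul_rpow (by positivity) (by positivity), hsq, Real.mul_rpow ha0 hb0]
  have e3 : (U + V) ^ (p / 2) ≤ 2 ^ (p / 2 - 1) * (U ^ (p / 2) + V ^ (p / 2)) := by
    have h := NNReal.rpow_add_le_mul_rpow_add_rpow ⟨U, hU0⟩ ⟨V, hV0⟩ hq
    exact_mod_cast h
  calc |a * c - b * d| ^ p = ((a * c - b * d) ^ 2) ^ (p / 2) := (hsq _).symm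
    _ ≤ (2 * (U + V)) ^ (p / 2) := Real.rpow_le_rpow (sq_nonneg _) key (by linarith)
    _ = 2 ^ (p / 2) * (U + V) ^ (p / 2) := Real.mul_rpow (by norm_num) (by positivity)
    _ ≤ 2 ^ (p / 2) * (2 ^ (p / 2 - 1) * (U ^ (p / 2) + V ^ (p / 2))) := by gcongr
    _ = 2 ^ (p - 1) * (U ^ (p / 2) + V ^ (p / 2)) := by
        rw [← mul_assoc, ← Real.rpow_add (by norm_num)]
        congr 2
        ring
    _ ≤ _ := by
        rw [e2]
        gcongr
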